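/- The extended block E⁽ᵈ⁾ is bounded: there exists a positive number n*, depending only on 𝔠, 𝔉, d, ε, τ, δ_{d−1}, C_{d−1} and D_{d−1}, such that E⁽ᵈ⁾ ⊆ {ξ ∈ ℤ^d : ‖ξ + κ‖ ≤ n*}; in particular E⁽ᵈ⁾ is a finite set. -/

import Mathlib

/-- A positive definite symmetric bilinear form on `ℝ^d`. -/
structure PDForm (d : ℕ) where
  B : (Fin d → ℝ) →ₗ[ℝ] (Fin d → ℝ) →ₗ[ℝ] ℝ
  symm : ∀ x y, B x y = B y x
  posdef : ∀ x, x ≠ 0 → 0 < B x x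

namespace PDForm

variable {d : ℕ} (g : PDForm d)

/-- The inner product `⟨·,·⟩` associated with the form. -/
def inn (x y : Fin d → ℝ) : ℝ := g.B x y

/-- The norm `‖·‖` associated with the form. -/
noncomputable def nrm (x : Fin d → ℝ) : ℝ := Real.sqrt (g.inn x x)

/-- The Japanese bracket `⟨x⟩ = (1+‖x‖²)^{1/2}`. -/
noncomputable def jap (x : Fin d → ℝ) : ℝ := Real.sqrt (1 + g.inn x x)

end PDForm

/-- Cast of a lattice vector of `ℤ^d` into `ℝ^d`. -/
def zc {d : ℕ} (k : Fin d → ℤ) : Fin d → ℝ := fun i => (k i : ℝ)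

/-- `𝔠 := min{‖k‖² : k ∈ ℤ^d, k ≠ 0}`. -/
noncomputable def frakc {d : ℕ} (g : PDForm d) : ℝ :=
  sInf {x | ∃ k : Fin d → ℤ, k ≠ 0 ∧ x = (g.nrm (zc k)) ^ 2}

/-- Gram volume `√det(⟨u_i,u_j⟩)` of an `s`-tuple of vectors. -/
noncomputable def gvol {d s : ℕ} (g : PDForm d) (u : Fin s → (Fin d → ℝ)) : ℝ :=
  Real.sqrt (Matrix.det (Matrix.of fun i j => g.inn (u i) (u j)))

/-- `𝔉`, the minimal Gram volume of parallelepipeds with linearly independent integer edges. -/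
noncomputable def frakC {d : ℕ} (g : PDForm d) : ℝ :=
  sInf {x | ∃ (s : ℕ) (u : Fin s → (Fin d → ℤ)), 1 ≤ s ∧ s ≤ d ∧
    LinearIndependent ℝ (fun j => zc (u j)) ∧ x = gvol g (fun j => zc (u j))}

/-- A submodule of `ℤ^d` in the sense of the paper: `span_ℝ(M) ∩ ℤ^d = M`. -/
def IsSat {d : ℕ} (M : Submodule ℤ (Fin d → ℤ)) : Prop :=
  ∀ k : Fin d → ℤ, zc k ∈ Submodule.span ℝ (zc '' (M : Set (Fin d → ℤ))) → k ∈ M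

/-- The dimension (rank) of a submodule of `ℤ^d`. -/
noncomputable def zrank {d : ℕ} (M : Submodule ℤ (Fin d → ℤ)) : ℕ := Module.finrank ℤ M

/-- `ξ_k := ξ + κ + k/2`. -/
noncomputable def xik {d : ℕ} (κ : Fin d → ℝ) (ξ k : Fin d → ℤ) : Fin d → ℝ :=
  fun i => (ξ i : ℝ) + κ i + (k i : ℝ) / 2

/-- All the data entering the definition of the resonant zones. -/
structure ZoneData (d : ℕ) where
  g : PDForm d
  κ : Fin d → ℝ
  E : Set (Fin d → ℤ)
  δ : ℝ
  ε : ℝ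
  τ : ℝ
  Cs : ℕ → ℝ
  Ds : ℕ → ℝ

namespace ZoneData

variable {d : ℕ} (Z : ZoneData d)

/-- `δ_s := δ + s (d+τ+1) ε`. -/
noncomputable def δs (s : ℕ) : ℝ := Z.δ + s * ((d + Z.τ + 1) * Z.ε)

/-- The completely nonresonant zone `Z⁽⁰⁾`. -/
noncomputable def Z0 : Set (Fin d → ℤ) :=
  {ξ | ξ ∈ Z.E ∧ ∀ k : Fin d → ℤ, k ≠ 0 →
    Z.g.nrm (zc k) ≤ (Z.g.jap (xik Z.κ ξ k)) ^ Z.ε →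
    |Z.g.inn (xik Z.κ ξ k) (zc k)| >
      (Z.g.jap (xik Z.κ ξ k)) ^ Z.δ * (Z.g.nrm (zc k)) ^ (-Z.τ)}

/-- The resonant zone `Z⁽ˢ⁾_M`, union over linearly independent `s`-tuples in `M`
of the zones `Z_{k₁,…,k_s}`. -/
noncomputable def ZM (s : ℕ) (M : Submodule ℤ (Fin d → ℤ)) : Set (Fin d → ℤ) :=
  {ξ | ξ ∈ Z.E ∧ ∃ (hs : 0 < s) (k : Fin s → (Fin d → ℤ)),
    (∀ j, k j ∈ M) ∧ LinearIndependent ℝ (fun j => zc (k j)) ∧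
    ∀ j : Fin s,
      |Z.g.inn (xik Z.κ ξ (k ⟨0, hs⟩)) (zc (k j))| ≤
        Z.Cs j * (Z.g.jap (xik Z.κ ξ (k ⟨0, hs⟩))) ^ (Z.δs j) * (Z.g.nrm (zc (k j))) ^ (-Z.τ) ∧
      Z.g.nrm (zc (k j)) ≤ Z.Ds j * (Z.g.jap (xik Z.κ ξ (k ⟨0, hs⟩))) ^ Z.ε}

/-- The resonant block `B⁽ˢ⁾_M`. -/
noncomputable def BM (s : ℕ) (M : Submodule ℤ (Fin d → ℤ)) : Set (Fin d → ℤ) :=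
  Z.ZM s M \
    ⋃ (M' : Submodule ℤ (Fin d → ℤ)) (_ : IsSat M' ∧ zrank M' = s + 1), Z.ZM (s + 1) M'

/-- The extended block `E⁽ˢ⁾_M` (for `s ≥ 1`). -/
noncomputable def EM : ℕ → Submodule ℤ (Fin d → ℤ) → Set (Fin d → ℤ)
  | s, M =>
    {ξ | (∃ b ∈ Z.BM s M, ∃ m ∈ M, ξ = b + m) ∧ ξ ∈ Z.ZM s M ∧
      ∀ r, 1 ≤ r → r < s → ∀ M' : Submodule ℤ (Fin d → ℤ),
        IsSat M' → zrank M' = r → ξ ∉ EM r M'}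
  termination_by s => s

end ZoneData

/-- Conditions on the parameters `δ, ε, τ`. -/
def ParamsOK (d : ℕ) (δ ε τ : ℝ) : Prop :=
  1 ≤ d ∧ 0 < δ ∧ δ < 1 ∧ 0 < ε ∧ (d : ℝ) - 1 < τ ∧
    δ + d * ((d + τ + 1) * ε) < 1 ∧ ε * (τ + 1) ≤ δ

/-- Conditions `1 = C₀ < C₁ < ⋯ < C_{d-1}` and `1 = D₀ < D₁ < ⋯ < D_{d-1}`. -/
def SeqOK (d : ℕ) (Cs Ds : ℕ → ℝ) : Prop :=
  Cs 0 = 1 ∧ Ds 0 = 1 ∧ (∀ j, j + 2 ≤ d → Cs j < Cs (j + 1)) ∧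
    (∀ j, j + 2 ≤ d → Ds j < Ds (j + 1))


section ResonantZones

open Matrix
open scoped MatrixOrder


theorem Matrix.PosSemidef.one_le_det_one_add {n : Type*} [Fintype n] [DecidableEq n]
    {P : Matrix n n ℝ} (hP : P.PosSemidef) : 1 ≤ (1 + P).det := by
  have h : (1 + P).det = ∏ i, (1 + hP.1.eigenvalues i) := by
    have h₁ := congrArg (Polynomial.eval (-1)) hP.1.charpoly_eq
    rw [Matrix.eval_charpoly, Polynomial.eval_prod] at h₁
    have h₂ : Matrix.scalar n (-1 : ℝ) - P = -(1 + P) := by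
      rw [map_neg, map_one]; abel
    rw [h₂, Matrix.det_neg] at h₁
    have h₃ : ∀ i, Polynomial.eval (-1) (Polynomial.X - Polynomial.C ((hP.1.eigenvalues i : ℝ)))
        = -1 * (1 + hP.1.eigenvalues i) := fun i => by simp; ring
    simp only [RCLike.ofReal_real_eq_id, id, h₃, Finset.prod_mul_distrib, Finset.prod_const,
      Finset.card_univ] at h₁
    exact mul_left_cancel₀ (pow_ne_zero _ (by norm_num)) h₁
  rw [h]
  calc (1 : ℝ) = ∏ _i : n, (1 : ℝ) := by simp
    _ ≤ _ := Finset.prod_le_prod (fun _ _ => zero_le_one) fun i _ => by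
      linarith [hP.eigenvalues_nonneg i]

theorem Matrix.PosDef.det_le_det_of_posSemidef_sub {n : Type*} [Fintype n] [DecidableEq n]
    {A B : Matrix n n ℝ} (hA : A.PosDef) (hAB : (B - A).PosSemidef) : A.det ≤ B.det := by
  obtain ⟨S, hS⟩ := CStarAlgebra.nonneg_iff_eq_star_mul_self.mp hA.posSemidef.nonneg
  have hdet : A.det = S.det ^ 2 := by
    rw [hS, star_eq_conjTranspose, det_mul, det_conjTranspose, star_trivial]; ring
  have hSu : IsUnit S.det := by
    rw [isUnit_iff_ne_zero]
    intro h
    have := hA.det_pos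
    simp [hdet, h] at this
  have hB : B = Sᴴ * (1 + (S⁻¹)ᴴ * (B - A) * S⁻¹) * S := by
    rw [mul_add, add_mul, mul_one, ← star_eq_conjTranspose, ← hS]
    have h₁ : star S * (star S⁻¹ * (B - A) * S⁻¹) * S = star (S⁻¹ * S) * (B - A) * (S⁻¹ * S) := by
      simp only [star_mul, mul_assoc]
    rw [← star_eq_conjTranspose, h₁, nonsing_inv_mul _ hSu]
    simp
  have h := (hAB.conjTranspose_mul_mul_same S⁻¹).one_le_det_one_add
  rw [hdet, hB, det_mul, det_mul, det_conjTranspose, star_trivial]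
  nlinarith [sq_nonneg S.det]

namespace PDForm

variable {d : ℕ} (g : PDForm d)

theorem inn_self_nonneg (x : Fin d → ℝ) : 0 ≤ g.inn x x := by
  by_cases h : x = 0
  · simp [h, inn]
  · exact (g.posdef x h).le

theorem inn_sq_le (x y : Fin d → ℝ) : g.inn x y ^ 2 ≤ g.inn x x * g.inn y y :=
  LinearMap.BilinForm.apply_sq_le_of_symm g.B g.inn_self_nonneg ⟨g.symm⟩ x y

theorem nrm_sq (x : Fin d → ℝ) : g.nrm x ^ 2 = g.inn x x := Real.sq_sqrt (g.inn_self_nonneg x)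

theorem nrm_nonneg (x : Fin d → ℝ) : 0 ≤ g.nrm x := Real.sqrt_nonneg _

theorem abs_inn_le (x y : Fin d → ℝ) : |g.inn x y| ≤ g.nrm x * g.nrm y := by
  refine abs_le_of_sq_le_sq ?_ (mul_nonneg (g.nrm_nonneg x) (g.nrm_nonneg y))
  rw [mul_pow, nrm_sq, nrm_sq]
  exact g.inn_sq_le x y

theorem jap_sq (x : Fin d → ℝ) : g.jap x ^ 2 = 1 + g.inn x x :=
  Real.sq_sqrt (by linarith [g.inn_self_nonneg x])

theorem one_le_jap (x : Fin d → ℝ) : 1 ≤ g.jap x :=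
  Real.one_le_sqrt.mpr (by linarith [g.inn_self_nonneg x])

/-- The Gram matrix of a tuple of vectors. -/
def gramMatrix {s : ℕ} (u : Fin s → Fin d → ℝ) : Matrix (Fin s) (Fin s) ℝ :=
  Matrix.of fun i j => g.inn (u i) (u j)

theorem gramMatrix_isHermitian {s : ℕ} (u : Fin s → Fin d → ℝ) : (g.gramMatrix u).IsHermitian := by
  ext i j
  simp [gramMatrix, inn, g.symm (u i)]

theorem gramMatrix_mulVec {s : ℕ} (u : Fin s → Fin d → ℝ) (a : Fin s → ℝ) (i : Fin s) :
    (g.gramMatrix u *ᵥ a) i = g.inn (u i) (∑ j, a j • u j) := by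
  simp [gramMatrix, inn, mulVec, dotProduct, mul_comm]

theorem dotProduct_gramMatrix_mulVec {s : ℕ} (u : Fin s → Fin d → ℝ) (a : Fin s → ℝ) :
    a ⬝ᵥ (g.gramMatrix u *ᵥ a) = g.inn (∑ j, a j • u j) (∑ j, a j • u j) := by
  simp only [dotProduct, gramMatrix_mulVec]
  rw [inn, map_sum]
  exact Finset.sum_congr rfl fun i _ => by rw [map_smul, smul_eq_mul, inn, g.symm]

theorem gramMatrix_posDef {s : ℕ} {u : Fin s → Fin d → ℝ} (hu : LinearIndependent ℝ u) :
    (g.gramMatrix u).PosDef := by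
  refine .of_dotProduct_mulVec_pos (g.gramMatrix_isHermitian u) fun a ha => ?_
  rw [star_trivial, dotProduct_gramMatrix_mulVec]
  refine g.posdef _ fun h => ha ?_
  exact funext (Fintype.linearIndependent_iff.mp hu a h)

theorem gvol_sq {s : ℕ} {u : Fin s → Fin d → ℝ} (hu : LinearIndependent ℝ u) :
    gvol g u ^ 2 = (g.gramMatrix u).det :=
  Real.sq_sqrt (g.gramMatrix_posDef hu).det_pos.le

/-- The standard Euclidean form on `ℝ^d`. -/
def euclid (d : ℕ) : PDForm d where
  B := dotProductBilin ℝ ℝ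
  symm x y := dotProduct_comm x y
  posdef x hx := by
    have := dotProduct_star_self_pos_iff.mpr hx
    simpa using this

theorem euclid_inn (x y : Fin d → ℝ) : (euclid d).inn x y = x ⬝ᵥ y := rfl

theorem exists_pos_mul_dotProduct_le : ∃ c : ℝ, 0 < c ∧ ∀ x, c * (x ⬝ᵥ x) ≤ g.inn x x := by
  have hcont : Continuous fun x : EuclideanSpace ℝ (Fin d) => g.inn x.ofLp x.ofLp := by
    have h : ∀ x : EuclideanSpace ℝ (Fin d), g.inn x.ofLp x.ofLp =
        LinearMap.toContinuousLinearMap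
          (LinearMap.toContinuousLinearMap.toLinearMap ∘ₗ g.B) x.ofLp x.ofLp := fun x => rfl
    simp only [h]
    fun_prop
  have hnorm : ∀ x : Fin d → ℝ, ‖WithLp.toLp 2 x‖ ^ 2 = x ⬝ᵥ x := fun x => by
    simp [EuclideanSpace.norm_sq_eq, dotProduct, ← sq]
  have hmem : ∀ x : Fin d → ℝ, x ≠ 0 → ‖WithLp.toLp 2 x‖⁻¹ • WithLp.toLp 2 x ∈
      Metric.sphere (0 : EuclideanSpace ℝ (Fin d)) 1 := fun x hx => by
    simp [norm_smul, show WithLp.toLp 2 x ≠ 0 by simpa using hx]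
  rcases (Metric.sphere (0 : EuclideanSpace ℝ (Fin d)) 1).eq_empty_or_nonempty with he | hne
  · refine ⟨1, one_pos, fun x => ?_⟩
    by_cases hx : x = 0
    · simp [hx, inn]
    · simpa [he] using hmem x hx
  · obtain ⟨v, hv, hmin⟩ := (isCompact_sphere _ _).exists_isMinOn hne hcont.continuousOn
    refine ⟨g.inn v.ofLp v.ofLp, g.posdef _ ?_, fun x => ?_⟩
    · intro h
      have : v = 0 := by simpa using h
      simp [this] at hv
    · by_cases hx : x = 0
      · simp [hx, inn]
      · have hpos : 0 < ‖WithLp.toLp 2 x‖ := norm_pos_iff.mpr (by simpa using hx)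
        have h := isMinOn_iff.mp hmin _ (hmem x hx)
        simp only [inn, WithLp.ofLp_smul, map_smul, LinearMap.smul_apply, smul_eq_mul] at h ⊢
        rw [← hnorm]
        calc _ ≤ _ := mul_le_mul_of_nonneg_right h (sq_nonneg _)
          _ = _ := by field_simp

theorem one_le_zc_dotProduct_zc {k : Fin d → ℤ} (hk : k ≠ 0) : 1 ≤ zc k ⬝ᵥ zc k := by
  have h : zc k ⬝ᵥ zc k = ((k ⬝ᵥ k : ℤ) : ℝ) := by simp [zc, dotProduct]
  have hpos : 0 < k ⬝ᵥ k := by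
    have := dotProduct_star_self_pos_iff.mpr hk
    simpa using this
  rw [h]
  exact_mod_cast hpos

theorem one_le_det_gramMatrix_euclid {s : ℕ} {u : Fin s → Fin d → ℤ}
    (hu : LinearIndependent ℝ fun j => zc (u j)) :
    1 ≤ ((euclid d).gramMatrix fun j => zc (u j)).det := by
  have hpos := ((euclid d).gramMatrix_posDef hu).det_pos
  have h : (euclid d).gramMatrix (fun j => zc (u j)) =
      (Matrix.of fun i j => u i ⬝ᵥ u j).map (Int.castRingHom ℝ) := by
    ext i j
    simp [gramMatrix, euclid_inn, zc, dotProduct]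
  rw [h, ← RingHom.mapMatrix_apply, ← RingHom.map_det] at hpos ⊢
  simp only [eq_intCast] at hpos ⊢
  exact_mod_cast hpos

theorem pow_le_det_gramMatrix {c : ℝ} (hc : 0 < c) (hg : ∀ x, c * (x ⬝ᵥ x) ≤ g.inn x x)
    {s : ℕ} {u : Fin s → Fin d → ℤ} (hu : LinearIndependent ℝ fun j => zc (u j)) :
    c ^ s ≤ (g.gramMatrix fun j => zc (u j)).det := by
  have hpd := ((euclid d).gramMatrix_posDef hu).smul hc
  calc c ^ s ≤ c ^ s * ((euclid d).gramMatrix fun j => zc (u j)).det :=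
        le_mul_of_one_le_right (by positivity) (one_le_det_gramMatrix_euclid hu)
    _ = (c • (euclid d).gramMatrix fun j => zc (u j)).det := by simp
    _ ≤ _ := by
      refine hpd.det_le_det_of_posSemidef_sub (.of_dotProduct_mulVec_nonneg
        ((g.gramMatrix_isHermitian _).sub hpd.1) fun a => ?_)
      rw [star_trivial, sub_mulVec, dotProduct_sub, smul_mulVec, dotProduct_smul,
        dotProduct_gramMatrix_mulVec, dotProduct_gramMatrix_mulVec, sub_nonneg]
      exact hg _

theorem frakc_pos (hd : 1 ≤ d) : 0 < frakc g := by
  obtain ⟨c, hc, hg⟩ := g.exists_pos_mul_dotProduct_le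
  refine hc.trans_le (le_csInf ?_ ?_)
  · exact ⟨_, Pi.single ⟨0, hd⟩ 1, by simp, rfl⟩
  · rintro _ ⟨k, hk, rfl⟩
    rw [nrm_sq]
    exact (le_mul_of_one_le_right hc.le (one_le_zc_dotProduct_zc hk)).trans (hg _)

theorem frakc_le {k : Fin d → ℤ} (hk : k ≠ 0) : frakc g ≤ g.nrm (zc k) ^ 2 :=
  csInf_le ⟨0, by rintro _ ⟨k, -, rfl⟩; positivity⟩ ⟨k, hk, rfl⟩

theorem frakC_pos (hd : 1 ≤ d) : 0 < frakC g := by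
  obtain ⟨c, hc, hg⟩ := g.exists_pos_mul_dotProduct_le
  have hm : 0 < min c 1 := lt_min hc one_pos
  refine (Real.sqrt_pos.mpr (pow_pos hm d)).trans_le (le_csInf ?_ ?_)
  · refine ⟨_, 1, fun _ => Pi.single ⟨0, hd⟩ 1, le_rfl, hd, ?_, rfl⟩
    rw [linearIndependent_unique_iff]
    intro h
    simpa [zc] using congrFun h ⟨0, hd⟩
  · rintro _ ⟨s, u, -, hs, hu, rfl⟩
    refine Real.sqrt_le_sqrt ?_
    calc min c 1 ^ d ≤ min c 1 ^ s := pow_le_pow_of_le_one hm.le (min_le_right _ _) hs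
      _ ≤ c ^ s := pow_le_pow_left₀ hm.le (min_le_left _ _) s
      _ ≤ _ := g.pow_le_det_gramMatrix hc hg hu

theorem frakC_sq_le {s : ℕ} (hs : 1 ≤ s) (hsd : s ≤ d) {u : Fin s → Fin d → ℤ}
    (hu : LinearIndependent ℝ fun j => zc (u j)) :
    frakC g ^ 2 ≤ (g.gramMatrix fun j => zc (u j)).det := by
  rw [← g.gvol_sq hu]
  refine pow_le_pow_left₀ (g.frakC_pos (hs.trans hsd)).le (csInf_le ⟨0, ?_⟩ ?_) 2
  · rintro _ ⟨s, u, -, -, -, rfl⟩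
    exact Real.sqrt_nonneg _
  · exact ⟨s, u, hs, hsd, hu, rfl⟩

theorem finite_setOf_nrm_le (κ : Fin d → ℝ) (n : ℝ) :
    {ξ : Fin d → ℤ | g.nrm (zc ξ + κ) ≤ n}.Finite := by
  obtain ⟨c, hc, hg⟩ := g.exists_pos_mul_dotProduct_le
  refine (Set.finite_Icc (fun i => ⌊-κ i - Real.sqrt (n ^ 2 / c)⌋)
    (fun i => ⌈-κ i + Real.sqrt (n ^ 2 / c)⌉)).subset fun ξ hξ => ?_
  have h₁ : ∀ i, |(ξ i : ℝ) + κ i| ≤ Real.sqrt (n ^ 2 / c) := fun i => by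
    refine Real.abs_le_sqrt ?_
    rw [le_div_iff₀' hc]
    calc c * ((ξ i : ℝ) + κ i) ^ 2 ≤ c * ((zc ξ + κ) ⬝ᵥ (zc ξ + κ)) := by
          refine mul_le_mul_of_nonneg_left ?_ hc.le
          rw [sq]
          exact Finset.single_le_sum (f := fun i => (zc ξ + κ) i * (zc ξ + κ) i)
            (fun j _ => mul_self_nonneg _) (Finset.mem_univ i)
      _ ≤ g.nrm (zc ξ + κ) ^ 2 := by rw [nrm_sq]; exact hg _
      _ ≤ n ^ 2 := pow_le_pow_left₀ (g.nrm_nonneg _) hξ 2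
  refine ⟨fun i => ?_, fun i => ?_⟩
  · have : (⌊-κ i - Real.sqrt (n ^ 2 / c)⌋ : ℝ) ≤ ξ i :=
      (Int.floor_le _).trans (by linarith [(abs_le.mp (h₁ i)).1])
    exact_mod_cast this
  · have : (ξ i : ℝ) ≤ ⌈-κ i + Real.sqrt (n ^ 2 / c)⌉ :=
      le_trans (by linarith [(abs_le.mp (h₁ i)).2]) (Int.le_ceil _)
    exact_mod_cast this

theorem abs_adjugate_gramMatrix_le {s : ℕ} {u : Fin s → Fin d → ℝ} {R : ℝ} (hR : 1 ≤ R)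
    (hu : ∀ j, g.nrm (u j) ≤ R) (i j : Fin s) :
    |(g.gramMatrix u).adjugate i j| ≤ s.factorial * (R ^ 2) ^ s := by
  have hR2 : 1 ≤ R ^ 2 := one_le_pow₀ hR
  rw [adjugate_apply]
  have h := Matrix.det_le (A := (g.gramMatrix u).updateRow j (Pi.single i 1))
    (abv := AbsoluteValue.abs) (x := R ^ 2) fun a b => ?_
  · simpa [AbsoluteValue.abs_apply] using h
  · rw [updateRow_apply, AbsoluteValue.abs_apply]
    split_ifs
    · by_cases hb : b = i
      · subst hb; simpa using hR2
      · simp [hb]; positivity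
    · refine (g.abs_inn_le _ _).trans ?_
      rw [sq]
      exact mul_le_mul (hu a) (hu b) (g.nrm_nonneg _) (by linarith)

/-- A vector is controlled by its inner products against a basis of bounded length and
nonvanishing Gram determinant. -/
theorem det_gramMatrix_mul_inn_self_le {u : Fin d → Fin d → ℝ} (hu : LinearIndependent ℝ u)
    {R β : ℝ} (hR : 1 ≤ R) (huR : ∀ j, g.nrm (u j) ≤ R) (x : Fin d → ℝ)
    (hβ : ∀ j, |g.inn x (u j)| ≤ β) :
    (g.gramMatrix u).det * g.inn x x ≤ d ^ 2 * (β ^ 2 * (d.factorial * (R ^ 2) ^ d)) := by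
  obtain ⟨a, ha⟩ : ∃ a : Fin d → ℝ, ∑ j, a j • u j = x := by
    have hspan := hu.span_eq_top_of_card_eq_finrank' (by simp)
    exact (Submodule.mem_span_range_iff_exists_fun ℝ).mp (hspan ▸ Submodule.mem_top)
  have hb : (g.gramMatrix u) *ᵥ a = fun j => g.inn x (u j) := funext fun j => by
    rw [gramMatrix_mulVec, ha]
    exact g.symm _ _
  have hx : g.inn x x = a ⬝ᵥ fun j => g.inn x (u j) := by
    rw [← hb, dotProduct_gramMatrix_mulVec, ha]
  have hda : (g.gramMatrix u).det • a = (g.gramMatrix u).adjugate *ᵥ fun j => g.inn x (u j) := by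
    rw [← hb, mulVec_mulVec, adjugate_mul, smul_mulVec, one_mulVec]
  rw [hx, ← smul_eq_mul, ← smul_dotProduct, hda]
  simp only [dotProduct, mulVec, Finset.sum_mul]
  calc _ ≤ ∑ _i : Fin d, ∑ _j : Fin d, β ^ 2 * (d.factorial * (R ^ 2) ^ d) := by
        refine Finset.sum_le_sum fun i _ => Finset.sum_le_sum fun j _ => (le_abs_self _).trans ?_
        have hβ₀ : 0 ≤ β := (abs_nonneg _).trans (hβ i)
        rw [abs_mul, abs_mul]
        calc _ ≤ (d.factorial * (R ^ 2) ^ d) * β * β := by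
              gcongr
              · exact g.abs_adjugate_gramMatrix_le hR huR i j
              · exact hβ j
              · exact hβ i
          _ = _ := by ring
    _ = _ := by simp; ring

theorem nrm_sub_le (x y : Fin d → ℝ) : g.nrm (x - y) ≤ g.nrm x + g.nrm y := by
  refine le_of_sq_le_sq ?_ (add_nonneg (g.nrm_nonneg x) (g.nrm_nonneg y))
  have h : g.inn (x - y) (x - y) = g.inn x x - 2 * g.inn x y + g.inn y y := by
    simp only [inn, map_sub, LinearMap.sub_apply, g.symm y x]
    ring
  rw [nrm_sq, h, add_sq, nrm_sq, nrm_sq]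
  linarith [neg_abs_le (g.inn x y), g.abs_inn_le x y]

theorem nrm_le_jap (x : Fin d → ℝ) : g.nrm x ≤ g.jap x :=
  Real.sqrt_le_sqrt (by linarith)

theorem nrm_half_smul_le (x : Fin d → ℝ) : g.nrm ((1 / 2 : ℝ) • x) ≤ g.nrm x := by
  refine Real.sqrt_le_sqrt ?_
  simp only [inn, map_smul, LinearMap.smul_apply, smul_eq_mul]
  have := g.inn_self_nonneg x
  simp only [inn] at this
  linarith

end PDForm

theorem le_last_of_lt_succ {d : ℕ} {a : ℕ → ℝ} (ha : ∀ j, j + 2 ≤ d → a j < a (j + 1))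
    {i : ℕ} (hi : i < d) : a i ≤ a (d - 1) := by
  have h : ∀ n, i + n < d → a i ≤ a (i + n) := fun n => by
    induction n with
    | zero => simp
    | succ n ih => exact fun hn => (ih (by omega)).trans (ha (i + n) (by omega)).le
  have := h (d - 1 - i) (by omega)
  rwa [show i + (d - 1 - i) = d - 1 by omega] at this

/-- If `J ≥ 1` satisfies `J² ≤ 1 + K J^{2σ}` with `σ < 1`, then `J` is bounded. -/
theorem le_rpow_of_sq_le_one_add_mul {J K σ : ℝ} (hJ : 1 ≤ J) (hσ₀ : 0 ≤ σ)
    (hσ : σ < 1) (h : J ^ 2 ≤ 1 + K * (J ^ σ) ^ 2) :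
    J ≤ Real.sqrt (1 + K) ^ (1 - σ)⁻¹ := by
  have hJ₀ : 0 < J := by linarith
  have h₁ : 1 ≤ J ^ σ := Real.one_le_rpow hJ hσ₀
  have hsplit : J = J ^ σ * J ^ (1 - σ) := by
    rw [← Real.rpow_add hJ₀, add_sub_cancel, Real.rpow_one]
  rw [Real.le_rpow_inv_iff_of_pos hJ₀.le (Real.sqrt_nonneg _) (by linarith)]
  refine Real.le_sqrt_of_sq_le ?_
  have hpos : 0 < (J ^ σ) ^ 2 := by positivity
  refine le_of_mul_le_mul_left ?_ hpos
  calc (J ^ σ) ^ 2 * (J ^ (1 - σ)) ^ 2 = J ^ 2 := by rw [← mul_pow, ← hsplit]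
    _ ≤ 1 + K * (J ^ σ) ^ 2 := h
    _ ≤ (J ^ σ) ^ 2 * (1 + K) := by nlinarith [one_le_pow₀ (n := 2) h₁]

/-- The constant `K` for which `⟨x⟩² ≤ 1 + K ⟨x⟩^{2σ}` holds at the points `x = ξ_{k₁}` with
`ξ` in the fully resonant zone. -/
noncomputable def resonanceConst (d : ℕ) (τ c F C D : ℝ) : ℝ :=
  d ^ 2 * ((C * Real.sqrt c ^ (-τ)) ^ 2 * (d.factorial * (D ^ 2) ^ d)) / F ^ 2

/-- The exponent `σ = δ_{d-1} + d ε`. -/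
noncomputable def resonanceExponent (d : ℕ) (δ ε τ : ℝ) : ℝ :=
  δ + ((d - 1 : ℕ) : ℝ) * ((d + τ + 1) * ε) + d * ε

theorem ParamsOK.resonanceExponent_nonneg {d : ℕ} {δ ε τ : ℝ} (h : ParamsOK d δ ε τ) :
    0 ≤ resonanceExponent d δ ε τ := by
  obtain ⟨hd, hδ, -, hε, hτ, -, -⟩ := h
  have : (1 : ℝ) ≤ d := by exact_mod_cast hd
  have : 0 ≤ d + τ + 1 := by linarith
  unfold resonanceExponent
  positivity

theorem ParamsOK.resonanceExponent_lt_one {d : ℕ} {δ ε τ : ℝ} (h : ParamsOK d δ ε τ) :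
    resonanceExponent d δ ε τ < 1 := by
  obtain ⟨hd, hδ, -, hε, hτ, h₁, -⟩ := h
  have : (1 : ℝ) ≤ d := by exact_mod_cast hd
  unfold resonanceExponent
  rw [Nat.cast_sub hd, Nat.cast_one]
  nlinarith [mul_nonneg (show 0 ≤ τ + 1 by linarith) hε.le]

theorem ParamsOK.eps_le_one {d : ℕ} {δ ε τ : ℝ} (h : ParamsOK d δ ε τ) : ε ≤ 1 := by
  obtain ⟨hd, -, hδ, hε, hτ, -, h₁⟩ := h
  have : (1 : ℝ) ≤ d := by exact_mod_cast hd
  nlinarith [mul_nonneg hε.le (show 0 ≤ τ by linarith)]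

theorem ZoneData.EM_subset_ZM {d : ℕ} (Z : ZoneData d) (s : ℕ)
    (M : Submodule ℤ (Fin d → ℤ)) : Z.EM s M ⊆ Z.ZM s M := fun ξ hξ => by
  rw [ZoneData.EM] at hξ
  exact hξ.2.1

theorem ZoneData.nrm_le_of_mem_ZM {d : ℕ} (Z : ZoneData d) (hpar : ParamsOK d Z.δ Z.ε Z.τ)
    (hseq : SeqOK d Z.Cs Z.Ds) {M : Submodule ℤ (Fin d → ℤ)} {ξ : Fin d → ℤ}
    (hξ : ξ ∈ Z.ZM d M) :
    Z.g.nrm (zc ξ + Z.κ) ≤ (1 + Z.Ds (d - 1)) *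
      Real.sqrt (1 + resonanceConst d Z.τ (frakc Z.g) (frakC Z.g) (Z.Cs (d - 1)) (Z.Ds (d - 1))) ^
        (1 - resonanceExponent d Z.δ Z.ε Z.τ)⁻¹ := by
  obtain ⟨-, hd, k, -, hk, hres⟩ := hξ
  obtain ⟨-, hδ, -, hε, hτ, -, -⟩ := id hpar
  obtain ⟨hC₀, hD₀, hC, hD⟩ := hseq
  have hd₁ : (1 : ℝ) ≤ d := by exact_mod_cast hd
  set x := xik Z.κ ξ (k ⟨0, hd⟩) with hx
  set J := Z.g.jap x with hJdef
  set C := Z.Cs (d - 1)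
  set D := Z.Ds (d - 1)
  have hJ : 1 ≤ J := Z.g.one_le_jap x
  have hJ₀ : 0 < J := by linarith
  have hC₁ : 1 ≤ C := hC₀ ▸ le_last_of_lt_succ hC hd
  have hD₁ : 1 ≤ D := hD₀ ▸ le_last_of_lt_succ hD hd
  have hJε : 1 ≤ J ^ Z.ε := Real.one_le_rpow hJ hε.le
  have hlen : ∀ j, Z.g.nrm (zc (k j)) ≤ D * J ^ Z.ε := fun j =>
    (hres j).2.trans (mul_le_mul_of_nonneg_right (le_last_of_lt_succ hD j.2) (by linarith))
  have hinn : ∀ j, |Z.g.inn x (zc (k j))| ≤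
      C * J ^ Z.δs (d - 1) * Real.sqrt (frakc Z.g) ^ (-Z.τ) := fun j => by
    have hkj : k j ≠ 0 := fun h => hk.ne_zero j (by funext i; simp [zc, h])
    have hc : Real.sqrt (frakc Z.g) ≤ Z.g.nrm (zc (k j)) :=
      (Real.sqrt_le_left (Z.g.nrm_nonneg _)).mpr (Z.g.frakc_le hkj)
    have hδj : Z.δs j ≤ Z.δs (d - 1) := by
      have hj : ((j : ℕ) : ℝ) ≤ ((d - 1 : ℕ) : ℝ) := by exact_mod_cast Nat.le_sub_one_of_lt j.2
      have : 0 ≤ (d + Z.τ + 1) * Z.ε := mul_nonneg (by linarith) hε.le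
      unfold ZoneData.δs
      gcongr
    refine (hres j).1.trans ?_
    refine mul_le_mul (mul_le_mul (le_last_of_lt_succ hC j.2)
      (Real.rpow_le_rpow_of_exponent_le hJ hδj) (by positivity) (by linarith)) ?_
      (Real.rpow_nonneg (Z.g.nrm_nonneg _) _) (by positivity)
    exact Real.rpow_le_rpow_of_nonpos (Real.sqrt_pos.mpr (Z.g.frakc_pos hd)) hc (by linarith)
  have hF := Z.g.frakC_pos hd
  have hmain := Z.g.det_gramMatrix_mul_inn_self_le hk (one_le_mul_of_one_le_of_one_le hD₁ hJε)
    hlen x hinn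
  have hvol := Z.g.frakC_sq_le hd le_rfl hk
  have hpow : J ^ resonanceExponent d Z.δ Z.ε Z.τ = J ^ Z.δs (d - 1) * (J ^ Z.ε) ^ d := by
    rw [← Real.rpow_mul_natCast hJ₀.le, ← Real.rpow_add hJ₀, resonanceExponent, ZoneData.δs,
      mul_comm Z.ε]
  have hJle : J ≤ Real.sqrt (1 + resonanceConst d Z.τ (frakc Z.g) (frakC Z.g) C D) ^
      (1 - resonanceExponent d Z.δ Z.ε Z.τ)⁻¹ := by
    refine le_rpow_of_sq_le_one_add_mul hJ
      hpar.resonanceExponent_nonneg hpar.resonanceExponent_lt_one ?_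
    rw [hJdef, Z.g.jap_sq, ← hJdef, resonanceConst, div_mul_eq_mul_div]
    refine add_le_add_right ((le_div_iff₀' (by positivity)).mpr ?_) 1
    calc _ ≤ _ := mul_le_mul_of_nonneg_right hvol (Z.g.inn_self_nonneg x)
      _ ≤ _ := hmain
      _ = _ := by rw [hpow]; ring
  have hsplit : zc ξ + Z.κ = x - (1 / 2 : ℝ) • zc (k ⟨0, hd⟩) := by
    funext i
    simp only [hx, xik, zc, Pi.add_apply, Pi.sub_apply, Pi.smul_apply, smul_eq_mul]
    ring
  calc Z.g.nrm (zc ξ + Z.κ) ≤ Z.g.nrm x + Z.g.nrm ((1 / 2 : ℝ) • zc (k ⟨0, hd⟩)) :=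
        hsplit ▸ Z.g.nrm_sub_le _ _
    _ ≤ J + D * J ^ (1 : ℝ) := by
        refine add_le_add (Z.g.nrm_le_jap x)
          ((Z.g.nrm_half_smul_le _).trans ((hlen _).trans ?_))
        exact mul_le_mul_of_nonneg_left (Real.rpow_le_rpow_of_exponent_le hJ hpar.eps_le_one)
          (by linarith)
    _ = (1 + D) * J := by rw [Real.rpow_one]; ring
    _ ≤ _ := mul_le_mul_of_nonneg_left hJle (by linarith)

end ResonantZones

/-- The extended block `E⁽ᵈ⁾` is bounded: there is `n* > 0`, depending
only on `𝔠, 𝔉, d, ε, τ, δ_{d-1}, C_{d-1}, D_{d-1}`, with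
`E⁽ᵈ⁾ ⊆ {ξ : ‖ξ+κ‖ ≤ n*}`; in particular `E⁽ᵈ⁾` is finite. -/
theorem statement5 (d : ℕ) (δ ε τ : ℝ) (hpar : ParamsOK d δ ε τ) :
    ∃ nstar : ℝ → ℝ → ℝ → ℝ → ℝ,
      (∀ a b c e, 0 < nstar a b c e) ∧
      ∀ (g : PDForm d) (κ : Fin d → ℝ) (E : Set (Fin d → ℤ)) (Cs Ds : ℕ → ℝ),
        SeqOK d Cs Ds →
        let Z : ZoneData d := ⟨g, κ, E, δ, ε, τ, Cs, Ds⟩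
        Z.EM d ⊤ ⊆ {ξ : Fin d → ℤ |
            g.nrm (zc ξ + κ) ≤ nstar (frakc g) (frakC g) (Cs (d - 1)) (Ds (d - 1))} ∧
        (Z.EM d ⊤).Finite := by
  refine ⟨fun a b c e => 1 + |(1 + e) * Real.sqrt (1 + resonanceConst d τ a b c e) ^
    (1 - resonanceExponent d δ ε τ)⁻¹|, fun a b c e => by positivity, ?_⟩
  intro g κ E Cs Ds hseq Z
  have hsub : Z.EM d ⊤ ⊆ {ξ : Fin d → ℤ | g.nrm (zc ξ + κ) ≤ 1 + |(1 + Ds (d - 1)) *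
      Real.sqrt (1 + resonanceConst d τ (frakc g) (frakC g) (Cs (d - 1)) (Ds (d - 1))) ^
        (1 - resonanceExponent d δ ε τ)⁻¹|} := fun ξ hξ => by
    have h := Z.nrm_le_of_mem_ZM hpar hseq (Z.EM_subset_ZM d ⊤ hξ)
    exact h.trans ((le_abs_self _).trans (by linarith))
  exact ⟨hsub, (g.finite_setOf_nrm_le κ _).subset hsub⟩
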